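/- arXiv:1402.5633 — 3 statements merged into one kernel-verified Lean document; each statement's English description precedes it below -/
import Mathlib

section
/- Let k be an odd prime, let N be an odd integer with N > 1 that is a multiple of k, set j = (k-1)/2, and let b_j be the residue of ((N+1)/2)^j modulo N (so 0 ≤ b_j < N and b_j ≡ ((N+1)/2)^j (mod N)). Then k divides 2^j − b_j; consequently the prime divisor k of N is detected by the quantity D = |b_j − 2^j| at step j = (k-1)/2. -/
/-- If `k` is an odd prime dividing the odd integer `N > 1`, `j = (k-1)/2`, and
`b_j` is the least nonnegative residue of `((N+1)/2)^j` modulo `N`, then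
`k` divides `2^j - b_j`: the prime divisor `k` of `N` is detected by the quantity
`D = |b_j - 2^j|` at step `j = (k-1)/2`. -/
theorem prime_dvd_pow_sub_residue (k : ℕ) (hk : Nat.Prime k) (hkodd : Odd k)
    (N : ℤ) (hN : 1 < N) (hNodd : Odd N) (hdvd : (k : ℤ) ∣ N)
    (j : ℕ) (hj : j = (k - 1) / 2)
    (bj : ℤ) (hbj : bj = ((N + 1) / 2) ^ j % N) :
    (k : ℤ) ∣ 2 ^ j - bj := by
  have : Fact k.Prime := ⟨hk⟩
  have hN0 : (N : ZMod k) = 0 := (ZMod.intCast_zmod_eq_zero_iff_dvd N k).2 hdvd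
  have hinv : (2 : ZMod k) * (((N + 1) / 2 : ℤ) : ZMod k) = 1 := by
    have h : 2 * ((N + 1) / 2) = N + 1 := Int.mul_ediv_cancel' hNodd.add_one.two_dvd
    simpa [hN0] using congrArg (Int.cast : ℤ → ZMod k) h
  have h2 : (2 : ZMod k) ≠ 0 := left_ne_zero_of_mul_eq_one hinv
  have hbj' : (bj : ZMod k) = (((N + 1) / 2 : ℤ) : ZMod k) ^ j := by
    rw [hbj, Int.emod_def, Int.cast_sub, Int.cast_mul, hN0, zero_mul, sub_zero, Int.cast_pow]
  have hfermat : (2 : ZMod k) ^ j * 2 ^ j = 1 := by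
    obtain ⟨m, rfl⟩ := hkodd
    have hjm : j + j = 2 * m + 1 - 1 := by omega
    rw [← pow_add, hjm, ZMod.pow_card_sub_one_eq_one h2]
  rw [← ZMod.intCast_zmod_eq_zero_iff_dvd, Int.cast_sub, hbj', sub_eq_zero]
  apply mul_left_cancel₀ (pow_ne_zero j h2)
  rw [← mul_pow 2 (_ : ZMod k), hinv, one_pow]
  exact_mod_cast hfermat
end

section
/- Let m be an odd natural number and N = 11m. Then 352 divides 1024 − (N+1)^5. -/
/-- If `m` is an odd natural number and `N = 11m`, then `352` divides `1024 - (N+1)^5`. -/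
theorem case_k_eleven (m : ℕ) (hm : Odd m) (N : ℤ) (hN : N = 11 * m) :
    (352 : ℤ) ∣ 1024 - (N + 1) ^ 5 := by
  obtain ⟨t, rfl⟩ := hm
  subst hN
  refine ⟨-(14641 * t ^ 5 + 39930 * t ^ 4 + 43560 * t ^ 3 + 23760 * t ^ 2 + 6480 * t + 704), ?_⟩
  push_cast
  ring
end

section
/- Let N be an odd composite integer with N > 1 and let L be the least prime divisor of N. Set j = (L-1)/2 and let b_j be the residue of ((N+1)/2)^j modulo N. Then L divides gcd(b_j − 2^j, N); in particular, a prime divisor of N is obtained in (L−1)/2 steps of the graph-pair algorithm. -/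
/-- Let `N` be an odd composite integer with `N > 1`, `L` its least prime divisor,
`j = (L-1)/2`, and `b_j` the least nonnegative residue of `((N+1)/2)^j` modulo `N`.
Then `L` divides `gcd(b_j - 2^j, N)`: a prime divisor of `N` is obtained in
`(L-1)/2` steps of the graph-pair algorithm. -/
theorem least_prime_divisor_dvd_gcd (N : ℕ) (hN : 1 < N) (hNodd : Odd N)
    (hcomp : ¬ Nat.Prime N) (L : ℕ) (hL : L = N.minFac)
    (j : ℕ) (hj : j = (L - 1) / 2)
    (bj : ℤ) (hbj : bj = (((N : ℤ) + 1) / 2) ^ j % (N : ℤ)) :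
    L ∣ Int.gcd (bj - 2 ^ j) (N : ℤ) := by
  subst hL
  have hp : Fact N.minFac.Prime := ⟨Nat.minFac_prime hN.ne'⟩
  have hLodd : Odd N.minFac := hNodd.of_dvd_nat N.minFac_dvd
  have hj2 : j + j = N.minFac - 1 := by
    obtain ⟨k, hk⟩ := hLodd
    omega
  have hdvd : (N.minFac : ℤ) ∣ (N : ℤ) := Int.natCast_dvd_natCast.mpr N.minFac_dvd
  have hN0 : ((N : ℤ) : ZMod N.minFac) = 0 := (ZMod.intCast_zmod_eq_zero_iff_dvd _ _).mpr hdvd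
  have hinv : ((((N : ℤ) + 1) / 2 : ℤ) : ZMod N.minFac) * 2 = 1 := by
    have h : ((N : ℤ) + 1) / 2 * 2 = N + 1 := by
      obtain ⟨k, hk⟩ := hNodd
      omega
    have h' := congrArg (Int.cast : ℤ → ZMod N.minFac) h
    rw [Int.cast_mul, Int.cast_add, hN0] at h'
    simpa using h'
  have hpow : ((((N : ℤ) + 1) / 2 : ℤ) : ZMod N.minFac) ^ j = 2 ^ j := by
    have hfermat : (2 : ZMod N.minFac) ^ j * 2 ^ j = 1 := by
      rw [← pow_add, hj2]
      exact ZMod.pow_card_sub_one_eq_one (right_ne_zero_of_mul_eq_one hinv)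
    rw [← mul_one (_ ^ j), ← hfermat, ← mul_assoc, ← mul_pow, hinv, one_pow, one_mul]
  have hb : (N.minFac : ℤ) ∣ bj - 2 ^ j := by
    rw [← ZMod.intCast_zmod_eq_zero_iff_dvd, hbj, Int.emod_def]
    simp only [Int.cast_sub, Int.cast_mul, Int.cast_pow, hN0, hpow]
    simp
  exact Int.natCast_dvd_natCast.mp (Int.dvd_coe_gcd hb hdvd)
end
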